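/- arXiv:2509.23183 — 2 statements merged into one kernel-verified Lean document; each statement's English description precedes it below -/
import Mathlib

section
/- (Lemma 1, Gradient dominance in entropy descent.) Let E_h = ℝ^k and E_f = ℝ^m be parameter spaces with Euclidean norms, F = ℝ^d a feature space, C a finite nonempty index type with n elements, δ ∈ (0,1], and η_h, η_f > 0 learning rates. Let f : E_f → F be Lipschitz with constant L_f > 0, let g : F → (C → ℝ) be a continuous linear map with operator norm ‖g‖, and let Φ : E_h × E_f → ℝ (the online-branch objective) be differentiable at φ(t) = (θ_h(t), θ_f(t)). Define the target-branch entropy G(θ_f) = H(σ(g(f(θ_f)))) and the encoder update θ_f(t+1) = θ_f(t) − η_f · v_f, where v_f is the E_f-block of the gradient ∇Φ(φ(t)) (the product space E_h × E_f carries the ℓ² product norm). If both σ(g(f(θ_f(t)))) and σ(g(f(θ_f(t+1)))) have all coordinates ≥ δ, then ‖∇Φ(φ(t))‖ ≥ |G(θ_f(t+1)) − G(θ_f(t))| / (√n · (|log δ| + 1) · ‖g‖ · L_f · max(η_h, η_f)). -/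
open Real Finset NNReal

/-- Softmax: `σ(u) c = exp (u c) / ∑ j, exp (u j)`. -/
noncomputable def softmax {C : Type*} [Fintype C] (u : C → ℝ) : C → ℝ :=
  fun c => Real.exp (u c) / ∑ j, Real.exp (u j)

/-- Shannon entropy `H(p) = −∑ c, p c * log (p c)` (natural log, `0 * log 0 = 0`). -/
noncomputable def entropy {C : Type*} [Fintype C] (p : C → ℝ) : ℝ :=
  -∑ c, p c * Real.log (p c)

theorem softmax_nonneg {C : Type*} [Fintype C] (u : C → ℝ) (c : C) : 0 ≤ softmax u c := by
  unfold softmax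
  positivity

theorem sum_exp_pos {C : Type*} [Fintype C] [Nonempty C] (u : C → ℝ) :
    0 < ∑ j, Real.exp (u j) :=
  Finset.sum_pos (fun _ _ => Real.exp_pos _) Finset.univ_nonempty

theorem sum_softmax {C : Type*} [Fintype C] [Nonempty C] (u : C → ℝ) :
    ∑ c, softmax u c = 1 := by
  unfold softmax
  rw [← Finset.sum_div, div_self (sum_exp_pos u).ne']

theorem softmax_le_one {C : Type*} [Fintype C] [Nonempty C] (u : C → ℝ) (c : C) :
    softmax u c ≤ 1 :=
  sum_softmax u ▸ Finset.single_le_sum (fun i _ => softmax_nonneg u i) (Finset.mem_univ c)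

/-- The derivative of the mean of `w` under the softmax along a line is a covariance. -/
theorem hasDerivAt_sum_mul_softmax {C : Type*} [Fintype C] [Nonempty C] (w v x : C → ℝ) (t : ℝ) :
    HasDerivAt (fun t : ℝ => ∑ c, w c * softmax (fun j => v j + t * x j) c)
      (∑ c, x c * (softmax (fun j => v j + t * x j) c *
        (w c - ∑ j, w j * softmax (fun j => v j + t * x j) j))) t := by
  have he (c : C) : HasDerivAt (fun t : ℝ => Real.exp (v c + t * x c))
      (Real.exp (v c + t * x c) * x c) t := by
    simpa using (((hasDerivAt_id t).mul_const (x c)).const_add (v c)).exp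
  have hN : HasDerivAt (fun t : ℝ => ∑ c, w c * Real.exp (v c + t * x c))
      (∑ c, w c * (Real.exp (v c + t * x c) * x c)) t :=
    HasDerivAt.fun_sum fun c _ => (he c).const_mul (w c)
  have hZ : HasDerivAt (fun t : ℝ => ∑ c, Real.exp (v c + t * x c))
      (∑ c, Real.exp (v c + t * x c) * x c) t :=
    HasDerivAt.fun_sum fun c _ => he c
  have hpos := sum_exp_pos fun j => v j + t * x j
  have hquot := hN.fun_div hZ hpos.ne'
  have hmean (t : ℝ) : ∑ c, w c * softmax (fun j => v j + t * x j) c =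
      (∑ c, w c * Real.exp (v c + t * x c)) / ∑ c, Real.exp (v c + t * x c) := by
    simp only [softmax, Finset.sum_div, mul_div_assoc]
  simp only [hmean]
  refine hquot.congr_deriv (Eq.symm ?_)
  simp only [softmax]
  generalize (∑ c, w c * Real.exp (v c + t * x c)) = N
  generalize (∑ c, Real.exp (v c + t * x c)) = Z at hpos ⊢
  rw [Finset.sum_mul, Finset.mul_sum, ← Finset.sum_sub_distrib, Finset.sum_div]
  refine Finset.sum_congr rfl fun c _ => ?_
  field_simp

/-- Cauchy–Schwarz bound on the covariance of `x` and `w` under `p`, for `w` bounded by `1`. -/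
theorem abs_sum_mul_mul_sub_mean_le {C : Type*} [Fintype C] (w p : C → ℝ)
    (x : EuclideanSpace ℝ C) (hp : ∀ c, 0 ≤ p c) (hp1 : ∀ c, p c ≤ 1) (hsum : ∑ c, p c = 1)
    (hw : ∀ c, w c ^ 2 ≤ 1) :
    |∑ c, x c * (p c * (w c - ∑ j, w j * p j))| ≤ ‖x‖ := by
  set e := ∑ j, w j * p j with he
  have hvar : ∑ c, (p c * (w c - e)) ^ 2 ≤ 1 := by
    calc ∑ c, (p c * (w c - e)) ^ 2 ≤ ∑ c, (p c - 2 * e * (w c * p c) + e ^ 2 * p c) := by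
          refine Finset.sum_le_sum fun c _ => ?_
          have h1 : p c ^ 2 ≤ p c := by nlinarith [hp c, hp1 c]
          have h2 := mul_le_mul_of_nonneg_right h1 (sq_nonneg (w c - e))
          have h3 := mul_le_mul_of_nonneg_left (hw c) (hp c)
          nlinarith
      _ = 1 - e ^ 2 := by
          rw [Finset.sum_add_distrib, Finset.sum_sub_distrib, ← Finset.mul_sum, ← Finset.mul_sum,
            hsum, ← he]
          ring
      _ ≤ 1 := by nlinarith [sq_nonneg e]
  have hcs := Finset.sum_mul_sq_le_sq_mul_sq Finset.univ (fun c => x c)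
    fun c => p c * (w c - e)
  refine abs_le_of_sq_le_sq ?_ (norm_nonneg x)
  rw [EuclideanSpace.real_norm_sq_eq]
  exact hcs.trans (mul_le_of_le_one_right (Finset.sum_nonneg fun c _ => sq_nonneg _) hvar)

/-- Softmax is `1`-Lipschitz from `ℓ²` to `ℓ¹`. -/
theorem sum_abs_softmax_sub_le {C : Type*} [Fintype C] [Nonempty C] (u v : EuclideanSpace ℝ C) :
    ∑ c, |softmax u c - softmax v c| ≤ ‖u - v‖ := by
  set w : C → ℝ := fun c => SignType.sign (softmax u c - softmax v c) with hwdef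
  have hw (c : C) : w c ^ 2 ≤ 1 := by
    simp only [hwdef]
    rcases SignType.sign (softmax u c - softmax v c) with _ | _ | _ <;> norm_num
  have hmvt := norm_image_sub_le_of_norm_deriv_le_segment_01'
    (fun t _ => (hasDerivAt_sum_mul_softmax w v (u - v) t).hasDerivWithinAt)
    (fun t _ => abs_sum_mul_mul_sub_mean_le w _ (u - v) (softmax_nonneg _) (softmax_le_one _)
      (sum_softmax _) hw)
  have hu : (fun j => v j + 1 * (u.ofLp - v.ofLp) j) = u := by
    funext j
    simp
  have hv : (fun j => v j + 0 * (u.ofLp - v.ofLp) j) = v := by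
    funext j
    simp
  rw [hu, hv, ← Finset.sum_sub_distrib] at hmvt
  refine le_trans (le_of_eq ?_) ((le_abs_self _).trans hmvt)
  refine Finset.sum_congr rfl fun c _ => ?_
  rw [← mul_sub, hwdef, sign_mul_self]

theorem abs_negMulLog_sub_le {δ p q : ℝ} (hδ : 0 < δ) (hp : p ∈ Set.Icc δ 1)
    (hq : q ∈ Set.Icc δ 1) :
    |Real.negMulLog p - Real.negMulLog q| ≤ (|Real.log δ| + 1) * |p - q| := by
  refine (convex_Icc δ 1).norm_image_sub_le_of_norm_deriv_le
    (fun y hy => (Real.hasDerivAt_negMulLog (hδ.trans_le hy.1).ne').differentiableAt)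
    (fun y hy => ?_) hq hp
  rw [Real.deriv_negMulLog (hδ.trans_le hy.1).ne', Real.norm_eq_abs]
  have h0 : Real.log y ≤ 0 := Real.log_nonpos (hδ.le.trans hy.1) hy.2
  have h1 : Real.log δ ≤ Real.log y := Real.log_le_log hδ hy.1
  rw [abs_of_nonpos (h1.trans h0), abs_le]
  constructor <;> linarith

theorem abs_entropy_sub_le {C : Type*} [Fintype C] {δ : ℝ} {p q : C → ℝ} (hδ : 0 < δ)
    (hp : ∀ c, p c ∈ Set.Icc δ 1) (hq : ∀ c, q c ∈ Set.Icc δ 1) :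
    |entropy p - entropy q| ≤ (|Real.log δ| + 1) * ∑ c, |p c - q c| := by
  have hH (r : C → ℝ) : entropy r = ∑ c, Real.negMulLog (r c) := by
    simp [entropy, Real.negMulLog]
  rw [hH, hH, ← Finset.sum_sub_distrib, Finset.mul_sum]
  exact (Finset.abs_sum_le_sum_abs _ _).trans
    (Finset.sum_le_sum fun c _ => abs_negMulLog_sub_le hδ (hp c) (hq c))

/-- (Lemma 1: Gradient dominance in entropy descent.)
Parameter spaces `E_h = ℝ^k`, `E_f = ℝ^m` (Euclidean), feature space `F = ℝ^d`,
learning rates `η_h, η_f > 0`, `f : E_f → F` Lipschitz with constant `L_f > 0`,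
`g : F → (C → ℝ)` continuous linear with operator norm `‖g‖`, and
`Φ : E_h × E_f → ℝ` (ℓ² product norm) differentiable at `φt = (θ_h, θ_f)`.
With `G(θ_f) = H(σ(g(f θ_f)))`, `v_f` the `E_f`-block of `∇Φ(φt)`, and encoder
update `θ_f' = θ_f − η_f • v_f`: if both `σ(g(f θ_f))` and `σ(g(f θ_f'))` have all
coordinates `≥ δ` (with `0 < δ ≤ 1`), then
`‖∇Φ(φt)‖ ≥ |G(θ_f') − G(θ_f)| / (√n · (|log δ| + 1) · ‖g‖ · L_f · max η_h η_f)`. -/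
theorem gradient_dominance_entropy_descent {k m d : ℕ} {C : Type*} [Fintype C] [Nonempty C]
    (n : ℕ) (hn : Fintype.card C = n)
    (δ : ℝ) (hδ0 : 0 < δ) (hδ1 : δ ≤ 1)
    (ηh ηf : ℝ) (hηh : 0 < ηh) (hηf : 0 < ηf)
    (Lf : ℝ≥0) (hLf : 0 < Lf)
    (f : EuclideanSpace ℝ (Fin m) → EuclideanSpace ℝ (Fin d))
    (hf : LipschitzWith Lf f)
    (g : EuclideanSpace ℝ (Fin d) →L[ℝ] EuclideanSpace ℝ C)
    (Φ : WithLp 2 (EuclideanSpace ℝ (Fin k) × EuclideanSpace ℝ (Fin m)) → ℝ)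
    (θh : EuclideanSpace ℝ (Fin k)) (θf : EuclideanSpace ℝ (Fin m))
    (φt : WithLp 2 (EuclideanSpace ℝ (Fin k) × EuclideanSpace ℝ (Fin m)))
    (hφt : φt = (WithLp.equiv 2 _).symm (θh, θf))
    (hΦ : DifferentiableAt ℝ Φ φt)
    (vf : EuclideanSpace ℝ (Fin m))
    (hvf : vf = ((WithLp.equiv 2 _) (gradient Φ φt)).2)
    (θf' : EuclideanSpace ℝ (Fin m))
    (hθf' : θf' = θf - ηf • vf)
    (hδt : ∀ c, δ ≤ softmax (g (f θf)) c)
    (hδt' : ∀ c, δ ≤ softmax (g (f θf')) c) :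
    ‖gradient Φ φt‖ ≥
      |entropy (softmax (g (f θf'))) - entropy (softmax (g (f θf)))| /
        (Real.sqrt n * (|Real.log δ| + 1) * ‖g‖ * (Lf : ℝ) * max ηh ηf) := by
  have hsqrt : 1 ≤ Real.sqrt n := by
    rw [Real.one_le_sqrt, Nat.one_le_cast, ← hn]
    exact Fintype.card_pos
  have hvfle : ‖vf‖ ≤ ‖gradient Φ φt‖ := hvf ▸ WithLp.norm_snd_le _ (gradient Φ φt)
  have hstep : ‖θf' - θf‖ ≤ max ηh ηf * ‖gradient Φ φt‖ := by
    rw [hθf', sub_sub_cancel_left, norm_neg, norm_smul, Real.norm_of_nonneg hηf.le]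
    gcongr
    exact le_max_right _ _
  have hlogits : ‖g (f θf') - g (f θf)‖ ≤ ‖g‖ * (Lf * ‖θf' - θf‖) := by
    rw [← map_sub]
    exact g.le_opNorm_of_le (hf.norm_sub_le _ _)
  have hentropy := abs_entropy_sub_le hδ0 (fun c => ⟨hδt' c, softmax_le_one _ c⟩)
    (fun c => ⟨hδt c, softmax_le_one _ c⟩)
  refine div_le_of_le_mul₀ (by positivity) (norm_nonneg _) ?_
  calc |entropy (softmax (g (f θf'))) - entropy (softmax (g (f θf)))|
      ≤ (|Real.log δ| + 1) * ‖g (f θf') - g (f θf)‖ :=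
        hentropy.trans (by gcongr; exact sum_abs_softmax_sub_le _ _)
    _ ≤ 1 * ((|Real.log δ| + 1) * (‖g‖ * (Lf * (max ηh ηf * ‖gradient Φ φt‖)))) := by
        rw [one_mul]
        gcongr
        exact hlogits.trans (by gcongr)
    _ ≤ Real.sqrt n * ((|Real.log δ| + 1) * (‖g‖ * (Lf * (max ηh ηf * ‖gradient Φ φt‖)))) := by
        gcongr
    _ = ‖gradient Φ φt‖ * (Real.sqrt n * (|Real.log δ| + 1) * ‖g‖ * Lf * max ηh ηf) := by
        ring
end

section
/- (Theorem 1(2), precise anti-collapse bound: bounded symmetric KL alignment to a δ-interior target keeps entropy bounded away from zero.) Let C be a finite index type with n ≥ 2 elements, let δ > 0 and B ≥ 0. Then there exists h_min > 0, depending only on n, δ and B, such that for all p, q in the probability simplex Δ(C) with p_c > 0 for every c, q_c ≥ δ for every c, and symmetric KL divergence D_SKL(p, q) = D_KL(p‖q) + D_KL(q‖p) ≤ B, one has H(p) ≥ h_min. -/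
open Real Finset

/-- Kullback–Leibler divergence `D_KL(p‖q) = ∑ c, p c * log (p c / q c)`
(for strictly positive finite distributions). -/
noncomputable def klDiv {C : Type*} [Fintype C] (p q : C → ℝ) : ℝ :=
  ∑ c, p c * Real.log (p c / q c)

/-- Symmetric KL divergence `D_SKL(p, q) = D_KL(p‖q) + D_KL(q‖p)`. -/
noncomputable def symKlDiv {C : Type*} [Fintype C] (p q : C → ℝ) : ℝ :=
  klDiv p q + klDiv q p

theorem symKlDiv_eq_sum {C : Type*} [Fintype C] {p q : C → ℝ}
    (hp : ∀ c, 0 < p c) (hq : ∀ c, 0 < q c) :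
    symKlDiv p q = ∑ c, (q c - p c) * (Real.log (q c) - Real.log (p c)) := by
  unfold symKlDiv klDiv
  rw [← Finset.sum_add_distrib]
  refine Finset.sum_congr rfl fun c _ => ?_
  rw [Real.log_div (hp c).ne' (hq c).ne', Real.log_div (hq c).ne' (hp c).ne']
  ring

theorem sub_mul_log_sub_log_nonneg {x y : ℝ} (hx : 0 < x) (hy : 0 < y) :
    0 ≤ (y - x) * (Real.log y - Real.log x) := by
  rcases le_total x y with h | h
  · exact mul_nonneg (sub_nonneg.2 h) (sub_nonneg.2 (Real.log_le_log hx h))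
  · exact mul_nonneg_of_nonpos_of_nonpos (sub_nonpos.2 h)
      (sub_nonpos.2 (Real.log_le_log hy h))

/-- A bound on the symmetric divergence to a `δ`-interior target keeps every coordinate
away from zero. -/
theorem le_apply_of_symKlDiv_le {C : Type*} [Fintype C] {p q : C → ℝ} {δ B : ℝ}
    (hδ : 0 < δ) (hB : 0 ≤ B) (hp : ∀ c, 0 < p c) (hq : ∀ c, δ ≤ q c)
    (h : symKlDiv p q ≤ B) (c : C) :
    δ / 2 * Real.exp (-(2 * B / δ)) ≤ p c := by
  have hq' : ∀ c, 0 < q c := fun c => hδ.trans_le (hq c)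
  rw [symKlDiv_eq_sum hp hq'] at h
  have hterm : (q c - p c) * (Real.log (q c) - Real.log (p c)) ≤ B :=
    (Finset.single_le_sum
      (f := fun c => (q c - p c) * (Real.log (q c) - Real.log (p c)))
      (fun d _ => sub_mul_log_sub_log_nonneg (hp d) (hq' d)) (Finset.mem_univ c)).trans h
  by_contra! hlt
  have hexp : Real.exp (-(2 * B / δ)) ≤ 1 := Real.exp_le_one_iff.2 (by
    have : 0 ≤ 2 * B / δ := by positivity
    linarith)
  have hhalf : p c < δ / 2 := by nlinarith
  have hlogp : Real.log (p c) < Real.log (δ / 2) - 2 * B / δ := by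
    have := Real.log_lt_log (hp c) hlt
    rwa [Real.log_mul (by positivity) (Real.exp_pos _).ne', Real.log_exp,
      ← sub_eq_add_neg] at this
  have hlogq : Real.log (δ / 2) ≤ Real.log (q c) :=
    Real.log_le_log (by positivity) (by linarith [hq c])
  have hdiff : 2 * B / δ < Real.log (q c) - Real.log (p c) := by linarith
  have hlower : B < (q c - p c) * (Real.log (q c) - Real.log (p c)) := calc
    B = δ / 2 * (2 * B / δ) := by field_simp
    _ < δ / 2 * (Real.log (q c) - Real.log (p c)) := by gcongr
    _ ≤ (q c - p c) * (Real.log (q c) - Real.log (p c)) := by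
      have : 0 ≤ 2 * B / δ := by positivity
      exact mul_le_mul_of_nonneg_right (by linarith [hq c]) (by linarith)
  linarith

/-- On a nontrivial index type, a distribution with all coordinates at least `ε` has entropy
at least `ε`. -/
theorem le_entropy_of_forall_le {C : Type*} [Fintype C] [Nontrivial C] {p : C → ℝ} {ε : ℝ}
    (hp : ∀ c, 0 < p c) (hsum : ∑ c, p c = 1) (hε : ∀ c, ε ≤ p c) :
    ε ≤ entropy p := by
  classical
  have hone : ∀ c, ε ≤ 1 - p c := fun c => by
    obtain ⟨d, hd⟩ := exists_ne c
    have := Finset.sum_le_sum_of_subset_of_nonneg (Finset.subset_univ {d, c})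
      (fun i _ _ => (hp i).le)
    rw [Finset.sum_pair hd, hsum] at this
    linarith [hε d]
  calc ε = ∑ c, p c * ε := by rw [← Finset.sum_mul, hsum, one_mul]
    _ ≤ ∑ c, -(p c * Real.log (p c)) := by
      refine Finset.sum_le_sum fun c _ => ?_
      rw [← mul_neg]
      exact mul_le_mul_of_nonneg_left
        (by linarith [hone c, Real.log_le_sub_one_of_pos (hp c)]) (hp c).le
    _ = entropy p := by rw [entropy, Finset.sum_neg_distrib]

/-- (Theorem 1(2), precise anti-collapse bound.)  For `n ≥ 2` classes, `δ > 0`,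
`B ≥ 0`, there exists `h_min > 0` (depending only on `n`, `δ`, `B`) such that every
strictly positive `p` in the simplex whose symmetric KL divergence to some
`δ`-interior `q` in the simplex is at most `B` satisfies `H(p) ≥ h_min`. -/
theorem entropy_lower_bound_of_bounded_symKl {C : Type*} [Fintype C]
    (n : ℕ) (hn : Fintype.card C = n) (hn2 : 2 ≤ n)
    (δ : ℝ) (hδ : 0 < δ) (B : ℝ) (hB : 0 ≤ B) :
    ∃ hmin : ℝ, 0 < hmin ∧
      ∀ p q : C → ℝ,
        (∀ c, 0 ≤ p c) → (∑ c, p c = 1) → (∀ c, 0 < p c) →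
        (∀ c, 0 ≤ q c) → (∑ c, q c = 1) → (∀ c, δ ≤ q c) →
        symKlDiv p q ≤ B →
        hmin ≤ entropy p := by
  have : Nontrivial C := Fintype.one_lt_card_iff_nontrivial.1 (by omega)
  refine ⟨δ / 2 * Real.exp (-(2 * B / δ)), by positivity, ?_⟩
  intro p q _ hpsum hp _ _ hq h
  exact le_entropy_of_forall_le hp hpsum (le_apply_of_symKlDiv_le hδ hB hp hq h)
end
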